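/- Let D be an open subset of ℝ^{n+p}, R : D → ℝ^{n+p} a C¹-mapping, E ∈ ℝ^{(n+p)×(n+p)} a matrix, and K̃ a compact subset of D. Fix T with 0 < T < ∞ and suppose there is a subset K ⊆ K̃ such that every solution x(t) of the ODE ẋ = R(x) + E x with x(0) ∈ K is defined on [0, T] and satisfies x(t) ∈ K̃ for all t ∈ [0, T]. Then for every ε > 0 there exist an integer m ≥ 1, a time constant τ > 0, an (n+p) × m matrix A, an m × (n+p) matrix B, and a vector θ ∈ ℝ^m with the following property: for every solution x(t) of ẋ = R(x) + E x with x(0) ∈ K, the (unique) solution z : [0,T] → ℝ^{n+p+m} of the forced recurrent-network ODE ż = −(1/τ)z + W σ(z) + H z, with block weight matrix W = [[0, A],[0, B A]], block matrix H whose first n+p rows equal (E, 0) and whose remaining m rows are zero, and initial state z(0) = (x(0), B x(0) + θ), satisfies max_{t ∈ [0,T]} ‖x(t) − ϖ(t)‖ < ε, where ϖ(t) ∈ ℝ^{n+p} denotes the first n+p components of z(t); in particular, the first n components of x(t) and of ϖ(t) stay within ε of each other for all t ∈ [0, T]. -/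

import Mathlib

/-- The logistic sigmoid function. -/
noncomputable def sigmoid (x : ℝ) : ℝ := 1 / (1 + Real.exp (-x))

theorem pow_mem_of_closed {A : Type*} [NormedCommRing A] [NormedAlgebra ℝ A] [CompleteSpace A]
    (S : Submodule ℝ A) (hS : IsClosed (S : Set A)) (w : A) (hw : ‖w‖ ≤ 1 / 4)
    (hg : ∀ k : ℕ, 1 ≤ k → ∃ g ∈ S, g * (1 + w ^ k) = w ^ k) : w ∈ S := by
  have hwk : ∀ k : ℕ, 1 ≤ k → ‖w ^ k‖ ≤ (1 / 4 : ℝ) ^ k := fun k hk =>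
    (norm_pow_le' w hk).trans (pow_le_pow_left₀ (norm_nonneg _) hw k)
  have key : ∀ n : ℕ, ∀ k : ℕ, 1 ≤ k → ‖S.mkQL (w ^ k)‖ ≤ (1 / 2 : ℝ) ^ n * (1 / 4) ^ k := by
    intro n
    induction n with
    | zero =>
      intro k hk
      simp only [pow_zero, one_mul]
      refine le_trans ?_ (hwk k hk)
      exact QuotientAddGroup.norm_mk_le_norm
    | succ n ih =>
      intro k hk
      obtain ⟨g, hgS, hge⟩ := hg k hk
      have h14 : (1 / 4 : ℝ) ^ k ≤ 1 / 4 := by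
        calc (1 / 4 : ℝ) ^ k ≤ (1 / 4 : ℝ) ^ 1 :=
              pow_le_pow_of_le_one (by norm_num) (by norm_num) hk
          _ = 1 / 4 := by norm_num
      have hlt : ‖-(w ^ k)‖ < 1 := by
        rw [norm_neg]; exact lt_of_le_of_lt ((hwk k hk).trans h14) (by norm_num)
      have hsum := summable_geometric_of_norm_lt_one hlt
      have hG := geom_series_mul_neg (-(w ^ k)) hlt
      set G := ∑' i : ℕ, (-(w ^ k)) ^ i with hGdef
      have heq : w ^ k - g = (w ^ k) ^ 2 * G := by
        have h1 : G * (1 + w ^ k) = 1 := by simpa using hG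
        linear_combination (g - w^k) * h1 + (-G) * hge
      have hs := (hsum.hasSum.mul_left ((w ^ k) ^ 2)).mapL S.mkQL
      rw [← hGdef, ← heq] at hs
      have hqg : S.mkQL g = 0 := by simpa using hgS
      rw [map_sub, hqg, sub_zero] at hs
      have hb : HasSum (fun j : ℕ => (1 / 2 : ℝ) ^ n * (1 / 4) ^ k * (1 / 4) * (1 / 4) ^ j)
          ((1 / 2 : ℝ) ^ n * (1 / 4) ^ k * (1 / 4) * (1 - 1 / 4)⁻¹) :=
        (hasSum_geometric_of_lt_one (by norm_num) (by norm_num)).mul_left _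
      refine (hs.norm_le_of_bounded hb ?_).trans ?_
      · intro j
        have e1 : (w ^ k) ^ 2 * (-(w ^ k)) ^ j = ((-1 : ℝ) ^ j) • w ^ (k * (j + 2)) := by
          rw [neg_pow, Algebra.smul_def]
          simp only [map_pow, map_neg, map_one]
          ring
        rw [e1, map_smul, norm_smul]
        have e2 : ‖(-1 : ℝ) ^ j‖ = 1 := by simp
        rw [e2, one_mul]
        refine (ih _ (by nlinarith)).trans ?_
        rw [mul_assoc, mul_assoc, ← pow_succ', ← pow_add]
        gcongr _ * ?_
        apply pow_le_pow_of_le_one (by norm_num) (by norm_num)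
        nlinarith
      · rw [pow_succ]
        have : 0 ≤ (1 / 2 : ℝ) ^ n * (1 / 4) ^ k := by positivity
        nlinarith
  have h0 : ‖S.mkQL w‖ ≤ 0 := by
    have ht : Filter.Tendsto (fun n : ℕ => (1 / 2 : ℝ) ^ n * (1 / 4) ^ 1) Filter.atTop
        (nhds (0 * (1 / 4) ^ 1)) :=
      (tendsto_pow_atTop_nhds_zero_of_lt_one (by norm_num) (by norm_num)).mul_const _
    rw [zero_mul] at ht
    refine ge_of_tendsto' ht fun n => ?_
    simpa using key n 1 le_rfl
  have : IsClosed (S : Set A) := hS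
  have h1 : S.mkQL w = 0 := norm_le_zero_iff.mp h0
  simpa using h1

theorem sigmoid_continuous : Continuous sigmoid := by
  unfold sigmoid
  refine continuous_const.div (by fun_prop) fun x => ?_
  positivity

/-- sigmoid of a continuous map -/
noncomputable def sigC {X : Type*} [TopologicalSpace X] (f : C(X, ℝ)) : C(X, ℝ) :=
  ⟨fun x => sigmoid (f x), sigmoid_continuous.comp f.continuous⟩

theorem universal_approx {X : Type*} [TopologicalSpace X] [CompactSpace X]
    (L : Submodule ℝ C(X, ℝ)) (u : C(X, ℝ)) (hu : u ∈ L) (a : ℝ) (ha : 0 < a)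
    (hua : ∀ x, a ≤ u x) (hsep : ∀ x y : X, x ≠ y → ∃ f ∈ L, f x ≠ f y) :
    (Submodule.span ℝ (sigC '' (L : Set C(X, ℝ)))).topologicalClosure = ⊤ := by
  set S := (Submodule.span ℝ (sigC '' (L : Set C(X, ℝ)))).topologicalClosure with hSdef
  have hSc : IsClosed (S : Set C(X, ℝ)) := Submodule.isClosed_topologicalClosure _
  have hsig : ∀ f ∈ L, sigC f ∈ S := fun f hf =>
    Submodule.le_topologicalClosure _ (Submodule.subset_span ⟨f, hf, rfl⟩)
  have hone : (1 : C(X, ℝ)) ∈ S := by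
    have := S.smul_mem 2 (hsig 0 L.zero_mem)
    convert this using 1
    ext x; simp [sigC, sigmoid]; norm_num
  let ex : C(X, ℝ) → C(X, ℝ) := fun f => ⟨fun x => Real.exp (-(f x)), by fun_prop⟩
  let P : Set C(X, ℝ) := {f | f ∈ L ∧ ∀ x, 2 ≤ f x}
  have hexp : ∀ f ∈ P, ex f ∈ S := by
    rintro f ⟨hfL, hf2⟩
    refine pow_mem_of_closed S hSc _ ?_ ?_
    · rw [ContinuousMap.norm_le _ (by norm_num)]
      intro x
      have h1 : Real.exp (-(f x)) ≤ Real.exp (-2) := Real.exp_le_exp.mpr (by linarith [hf2 x])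
      have h2 : Real.exp (-2) ≤ 1 / 4 := by
        rw [Real.exp_neg, one_div]
        apply inv_anti₀ (by norm_num)
        have := Real.add_one_le_exp (1 : ℝ)
        have h3 : Real.exp 2 = Real.exp 1 * Real.exp 1 := by rw [← Real.exp_add]; norm_num
        nlinarith
      simp only [ex, ContinuousMap.coe_mk, Real.norm_eq_abs, abs_of_pos (Real.exp_pos _)]
      linarith
    · intro k hk
      refine ⟨1 - sigC ((k : ℝ) • f), S.sub_mem hone (hsig _ (L.smul_mem _ hfL)), ?_⟩
      ext x
      simp only [ex, sigC, sigmoid, ContinuousMap.coe_mul, ContinuousMap.coe_sub,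
        ContinuousMap.coe_one, ContinuousMap.coe_add, ContinuousMap.coe_pow, ContinuousMap.coe_mk,
        Pi.mul_apply, Pi.sub_apply, Pi.add_apply, Pi.one_apply, Pi.pow_apply,
        ContinuousMap.coe_smul, Pi.smul_apply, smul_eq_mul]
      rw [← Real.exp_nat_mul, mul_neg]
      have := Real.exp_pos (-((k : ℝ) * f x))
      field_simp
      ring
  have hmul : ∀ f g, ex f * ex g = ex (f + g) := by
    intro f g; ext x
    simp [ex, ← Real.exp_add, add_comm]
  -- the submonoid
  let M : Submonoid C(X, ℝ) :=
    { carrier := {h | h = 1 ∨ ∃ f ∈ P, h = ex f}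
      one_mem' := Or.inl rfl
      mul_mem' := by
        rintro _ _ (rfl | ⟨f, hf, rfl⟩) (rfl | ⟨g, hg, rfl⟩)
        · left; simp
        · right; exact ⟨g, hg, by simp⟩
        · right; exact ⟨f, hf, by simp⟩
        · right
          refine ⟨f + g, ⟨L.add_mem hf.1 hg.1, fun x => ?_⟩, hmul f g⟩
          have := hf.2 x
          have := hg.2 x
          simp only [ContinuousMap.add_apply]
          linarith }
  have hMS : ∀ h ∈ M, h ∈ S := by
    rintro _ (rfl | ⟨f, hf, rfl⟩)
    · exact hone
    · exact hexp f hf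
  let A := Algebra.adjoin ℝ (M : Set C(X, ℝ))
  have hAS : Subalgebra.toSubmodule A ≤ S := by
    rw [Algebra.adjoin_eq_span, Submonoid.closure_eq, Submodule.span_le]
    exact hMS
  have hAsep : A.SeparatesPoints := by
    intro x y hxy
    have hP : ∃ f ∈ P, f x ≠ f y := by
      obtain ⟨f, hf, hfxy⟩ := hsep x y hxy
      have hPc : ∀ c : ℝ, (‖f‖ + 2) / a ≤ c → c • u + f ∈ P := by
        intro c hc
        refine ⟨L.add_mem (L.smul_mem _ hu) hf, fun z => ?_⟩
        simp only [ContinuousMap.add_apply, ContinuousMap.smul_apply, smul_eq_mul]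
        have h1 := f.norm_coe_le_norm z
        rw [Real.norm_eq_abs] at h1
        have h2 := neg_abs_le (f z)
        rw [div_le_iff₀ ha] at hc
        have hc0 : 0 ≤ c := by
          by_contra hcn
          push Not at hcn
          nlinarith [norm_nonneg f]
        nlinarith [hua z]
      by_contra! hcon
      have h1 := hcon _ (hPc _ le_rfl)
      have h2 := hcon _ (hPc ((‖f‖ + 2) / a + 1) (by linarith))
      simp only [ContinuousMap.add_apply, ContinuousMap.smul_apply, smul_eq_mul] at h1 h2
      have h3 : u x = u y := by linarith
      rw [h3] at h1
      exact hfxy (by linarith)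
    obtain ⟨f, hf, hne⟩ := hP
    refine ⟨ex f, ⟨ex f, Algebra.subset_adjoin (Or.inr ⟨f, hf, rfl⟩), rfl⟩, ?_⟩
    simpa [ex] using hne
  have htop := ContinuousMap.subalgebra_topologicalClosure_eq_top_of_separatesPoints A hAsep
  rw [eq_top_iff]
  intro f _
  have hf : f ∈ A.topologicalClosure := by rw [htop]; trivial
  have : f ∈ closure (A : Set C(X, ℝ)) := hf
  exact closure_minimal (fun g hg => hAS hg) hSc this

theorem network_approx {ι : Type*} [Fintype ι] (N : Set (EuclideanSpace ℝ ι)) (hN : IsCompact N)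
    (F : EuclideanSpace ℝ ι → EuclideanSpace ℝ ι) (hF : ContinuousOn F N)
    (a : ℝ) (ha : 0 < a) (δ : ℝ) (hδ : 0 < δ) :
    ∃ (m : ℕ) (A : Matrix ι (Fin m) ℝ) (B : Matrix (Fin m) ι ℝ) (θ : EuclideanSpace ℝ (Fin m)),
      1 ≤ m ∧ ∀ y ∈ N, ∀ s ∈ Set.Icc a 1,
        ‖WithLp.toLp 2 (A.mulVec (fun j => sigmoid (B.mulVec y j + s * θ j))) - F y‖ < δ := by
  classical
  let X := (N ×ˢ Set.Icc a 1 : Set (EuclideanSpace ℝ ι × ℝ))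
  have hX : IsCompact X := hN.prod isCompact_Icc
  have : CompactSpace X := isCompact_iff_compactSpace.mp hX
  let lin : ((ι → ℝ) × ℝ) →ₗ[ℝ] C(X, ℝ) :=
    { toFun := fun b => ⟨fun q => (∑ i, b.1 i * q.1.1 i) + q.1.2 * b.2, by fun_prop⟩
      map_add' := by
        intro b c; ext q
        simp only [Prod.fst_add, Prod.snd_add, Pi.add_apply, add_mul, mul_add,
          Finset.sum_add_distrib, ContinuousMap.coe_mk, ContinuousMap.add_apply]
        ring
      map_smul' := by
        intro c b; ext q
        simp only [Prod.smul_fst, Prod.smul_snd, Pi.smul_apply, smul_eq_mul, RingHom.id_apply,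
          ContinuousMap.coe_mk, ContinuousMap.smul_apply, mul_add, Finset.mul_sum]
        congr 1
        · exact Finset.sum_congr rfl fun i _ => by ring
        · ring }
  have hlin : ∀ b (q : X), lin b q = (∑ i, b.1 i * q.1.1 i) + q.1.2 * b.2 := fun _ _ => rfl
  have hdense := universal_approx (LinearMap.range lin) (lin (0, 1)) ⟨_, rfl⟩ a ha
    (fun x => by simpa [hlin] using x.2.2.1) (by
      intro x y hxy
      by_contra! hcon
      apply hxy
      apply Subtype.ext
      apply Prod.ext
      · ext i
        have := hcon (lin (Pi.single i 1, 0)) ⟨_, rfl⟩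
        simpa [hlin, Pi.single_apply] using this
      · have := hcon (lin (0, 1)) ⟨_, rfl⟩
        simpa [hlin] using this)
  have himg : sigC '' ((LinearMap.range lin : Submodule ℝ C(X, ℝ)) : Set C(X, ℝ))
      = Set.range (fun b => sigC (lin b)) := by
    ext f; simp [Set.mem_image]
  rw [himg] at hdense
  -- approximate every component
  set d : ℝ := δ / (Real.sqrt (Fintype.card ι) + 1) with hd
  have hd0 : 0 < d := by positivity
  have hcomp : ∀ i : ι, ∃ c : ((ι → ℝ) × ℝ) →₀ ℝ, ∀ q : X,
      |(c.sum fun b r => r * sigmoid (lin b q)) - F q.1.1 i| < d := by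
    intro i
    have hFc : Continuous (fun q : X => F q.1.1 i) := by
      have h1 : Continuous (fun q : X => F q.1.1) :=
        hF.comp_continuous (by fun_prop) (fun q => q.2.1)
      have h2 : Continuous (fun v : EuclideanSpace ℝ ι => v i) := by fun_prop
      exact h2.comp h1
    let Fi : C(X, ℝ) := ⟨_, hFc⟩
    have hmem : Fi ∈ closure ((Submodule.span ℝ (Set.range (fun b => sigC (lin b))) :
        Submodule ℝ C(X, ℝ)) : Set C(X, ℝ)) := by
      have : Fi ∈ (Submodule.span ℝ (Set.range (fun b => sigC (lin b)))).topologicalClosure := by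
        rw [hdense]; trivial
      exact this
    obtain ⟨g, hg, hgd⟩ := Metric.mem_closure_iff.mp hmem d hd0
    obtain ⟨c, hc⟩ := Finsupp.mem_span_range_iff_exists_finsupp.mp hg
    refine ⟨c, fun q => ?_⟩
    have h1 := ContinuousMap.dist_apply_le_dist (f := Fi) (g := g) q
    have h2 : g q = c.sum fun b r => r * sigmoid (lin b q) := by
      rw [← hc, Finsupp.sum, Finsupp.sum]
      simp [sigC]
    rw [← h2]
    rw [dist_comm, Real.dist_eq] at h1
    exact lt_of_le_of_lt h1 hgd
  choose c hc using hcomp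
  let t : Finset ((ι → ℝ) × ℝ) := insert 0 (Finset.univ.biUnion fun i => (c i).support)
  let e := t.equivFin
  refine ⟨t.card, Matrix.of fun i j => c i (e.symm j), Matrix.of fun j i => (e.symm j).1.1 i,
    WithLp.toLp 2 fun j => (e.symm j).1.2, Finset.card_pos.mpr ⟨0, by simp [t]⟩, ?_⟩
  intro y hy s hs
  let q : X := ⟨(y, s), hy, hs⟩
  have hval : ∀ i, (Matrix.of fun i j => c i (e.symm j)).mulVec (fun j => sigmoid
      ((Matrix.of fun j i => (e.symm j).1.1 i).mulVec y j
        + s * (WithLp.toLp 2 fun j => (e.symm j).1.2 : EuclideanSpace ℝ (Fin t.card)) j)) i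
      = (c i).sum fun b r => r * sigmoid (lin b q) := by
    intro i
    have hsub : (c i).support ⊆ t := by
      intro b hb
      apply Finset.mem_insert_of_mem
      exact Finset.mem_biUnion.mpr ⟨i, Finset.mem_univ _, hb⟩
    rw [Finsupp.sum_of_support_subset _ hsub _ (by simp)]
    rw [← Finset.sum_coe_sort, ← e.symm.sum_comp]
    rfl
  have hle : ‖WithLp.toLp 2 ((Matrix.of fun i j => c i (e.symm j)).mulVec (fun j => sigmoid
      ((Matrix.of fun j i => (e.symm j).1.1 i).mulVec y j
        + s * (WithLp.toLp 2 fun j => (e.symm j).1.2 : EuclideanSpace ℝ (Fin t.card)) j)))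
        - F y‖ ≤ Real.sqrt (Fintype.card ι) * d := by
    rw [EuclideanSpace.norm_eq]
    have : Real.sqrt (Fintype.card ι) * d = Real.sqrt (Fintype.card ι * d ^ 2) := by
      rw [Real.sqrt_mul (by positivity), Real.sqrt_sq hd0.le]
    rw [this]
    apply Real.sqrt_le_sqrt
    calc _ ≤ ∑ i : ι, d ^ 2 := by
          apply Finset.sum_le_sum
          intro i _
          refine pow_le_pow_left₀ (norm_nonneg _) ?_ 2
          rw [PiLp.sub_apply, Real.norm_eq_abs]
          have := (hc i q).le
          rw [← hval i] at this
          exact this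
      _ = _ := by simp
  refine lt_of_le_of_lt hle ?_
  rw [hd, mul_div_assoc', div_lt_iff₀ (by positivity)]
  nlinarith [Real.sqrt_nonneg (Fintype.card ι : ℝ)]

theorem exists_lag {V H : Type*} [NormedAddCommGroup V] [NormedSpace ℝ V] [CompleteSpace V]
    [NormedAddCommGroup H] [NormedSpace ℝ H]
    (T τ : ℝ) (hT : 0 < T) (Em : V →L[ℝ] V) (Bl : V →L[ℝ] H) (q : H → V) (θ : H)
    (ω : ℝ → V) (h : ℝ → H)
    (hω : ∀ t ∈ Set.Icc (0 : ℝ) T,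
      HasDerivAt ω ((-(1 / τ)) • ω t + q (h t) + Em (ω t)) t)
    (hh : ∀ t ∈ Set.Icc (0 : ℝ) T,
      HasDerivAt h ((-(1 / τ)) • h t + Bl (q (h t))) t)
    (h0 : h 0 = Bl (ω 0) + θ) :
    ∃ w : ℝ → V, w 0 = 0 ∧
      (∀ t ∈ Set.Icc (0 : ℝ) T, HasDerivAt w ((-(1 / τ)) • w t + Em (ω t)) t) ∧
      ∀ t ∈ Set.Icc (0 : ℝ) T, h t = Bl (ω t - w t) + Real.exp (-(1 / τ) * t) • θ := by
  have hωc : ContinuousOn ω (Set.Icc 0 T) := fun t ht => (hω t ht).continuousAt.continuousWithinAt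
  let g : ℝ → V := Set.IccExtend hT.le ((Set.Icc (0 : ℝ) T).domRestrict ω)
  have hg : Continuous g := (continuousOn_iff_continuous_domRestrict.mp hωc).Icc_extend'
  have hge : ∀ t ∈ Set.Icc (0 : ℝ) T, g t = ω t := fun t ht => by
    simp only [g]; rw [Set.IccExtend_of_mem _ _ ht]; rfl
  let k : ℝ → V := fun r => Real.exp ((1 / τ) * r) • Em (g r)
  have hk : Continuous k := by fun_prop
  let v : ℝ → V := fun t => ∫ r in (0 : ℝ)..t, k r
  have hv : ∀ t, HasDerivAt v (k t) t := fun t =>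
    intervalIntegral.integral_hasDerivAt_right (hk.intervalIntegrable _ _)
      (hk.stronglyMeasurableAtFilter _ _) hk.continuousAt
  have hexp : ∀ c t : ℝ, HasDerivAt (fun t => Real.exp (c * t)) (Real.exp (c * t) * c) t := by
    intro c t
    simpa using ((hasDerivAt_id t).const_mul c).exp
  have hw : ∀ t ∈ Set.Icc (0 : ℝ) T,
      HasDerivAt (fun t => Real.exp (-(1 / τ) * t) • v t)
        ((-(1 / τ)) • (Real.exp (-(1 / τ) * t) • v t) + Em (ω t)) t := by
    intro t ht
    refine HasDerivAt.congr_deriv ((hexp (-(1 / τ)) t).smul (hv t)) ?_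
    have : Real.exp (-(1 / τ) * t) • k t = Em (ω t) := by
      simp only [k]
      rw [hge t ht, smul_smul, ← Real.exp_add]
      simp
    rw [this, add_comm, smul_smul, mul_comm]
  refine ⟨fun t => Real.exp (-(1 / τ) * t) • v t, by simp [v], hw, ?_⟩
  set w := fun t => Real.exp (-(1 / τ) * t) • v t with hwdef
  have hw0 : w 0 = 0 := by simp [w, v]
  -- the conserved quantity
  have hP : ∀ t ∈ Set.Icc (0 : ℝ) T,
      HasDerivAt (fun t => Real.exp ((1 / τ) * t) • (h t - Bl (ω t - w t))) 0 t := by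
    intro t ht
    have h1 := (hh t ht).sub (Bl.hasFDerivAt.comp_hasDerivAt t ((hω t ht).sub (hw t ht)))
    have h2 := (hexp (1 / τ) t).smul h1
    refine HasDerivAt.congr_deriv h2 ?_
    simp only [Function.comp, Pi.sub_apply, map_sub, map_add, map_smul, hwdef]
    module
  have hconst := constant_of_has_deriv_right_zero
    (fun t ht => (hP t ht).continuousAt.continuousWithinAt)
    (fun t ht => (hP t ⟨ht.1, ht.2.le⟩).hasDerivWithinAt)
  intro t ht
  have h1 := hconst t ht
  simp only [mul_zero, Real.exp_zero, one_smul, hw0, sub_zero, h0, add_sub_cancel_left] at h1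
  rw [← h1, smul_smul, ← Real.exp_add]
  simp

theorem lag_small {V : Type*} [NormedAddCommGroup V] [NormedSpace ℝ V]
    (T τ M r : ℝ) (Em : V →L[ℝ] V)
    (ω w : ℝ → V) (hw0 : w 0 = 0) (hr : 0 < r)
    (hw : ∀ t ∈ Set.Icc (0 : ℝ) T, HasDerivAt w ((-(1 / τ)) • w t + Em (ω t)) t)
    (hM : ∀ t ∈ Set.Icc (0 : ℝ) T, ‖ω t - w t‖ ≤ M)
    (hrM : ‖Em‖ * (r + M) < r / τ) :
    ∀ t ∈ Set.Icc (0 : ℝ) T, ‖w t‖ ≤ r := by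
  have hexp : ∀ c t : ℝ, HasDerivAt (fun t => Real.exp (c * t)) (Real.exp (c * t) * c) t := by
    intro c t
    simpa using ((hasDerivAt_id t).const_mul c).exp
  have hv : ∀ t ∈ Set.Icc (0 : ℝ) T,
      HasDerivAt (fun t => Real.exp ((1 / τ) * t) • w t)
        (Real.exp ((1 / τ) * t) • Em (ω t)) t := by
    intro t ht
    refine HasDerivAt.congr_deriv ((hexp (1 / τ) t).smul (hw t ht)) ?_
    module
  have key := image_norm_le_of_norm_deriv_right_lt_deriv_boundary (a := 0) (b := T)
    (B := fun t => Real.exp ((1 / τ) * t) * r)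
    (fun t ht => (hv t ht).continuousAt.continuousWithinAt)
    (fun t ht => (hv t ⟨ht.1, ht.2.le⟩).hasDerivWithinAt)
    (by simp [hw0, hr.le]) (fun t => (hexp (1 / τ) t).mul_const r) (by
      intro t ht heq
      have hpos := Real.exp_pos ((1 / τ) * t)
      rw [norm_smul, Real.norm_of_nonneg hpos.le] at heq ⊢
      have h1 : ‖w t‖ = r := mul_left_cancel₀ hpos.ne' heq
      have h2 : ‖ω t‖ ≤ r + M := by
        have := norm_add_le (w t) (ω t - w t)
        rw [add_sub_cancel] at this
        linarith [hM t ⟨ht.1, ht.2.le⟩]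
      rw [mul_assoc]
      apply mul_lt_mul_of_pos_left _ hpos
      calc ‖Em (ω t)‖ ≤ ‖Em‖ * ‖ω t‖ := Em.le_opNorm _
        _ ≤ ‖Em‖ * (r + M) := by gcongr
        _ < r / τ := hrM
        _ = 1 / τ * r := by ring)
  intro t ht
  have h1 := key ht
  have hpos := Real.exp_pos ((1 / τ) * t)
  rw [norm_smul, Real.norm_of_nonneg hpos.le] at h1
  exact le_of_mul_le_mul_left h1 hpos

theorem tracking {V : Type*} [NormedAddCommGroup V] [NormedSpace ℝ V]
    (T L η δ : ℝ) (hL : 0 ≤ L) (hδ : 0 < δ)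
    (hδη : δ * Real.exp ((L + 1) * T) ≤ η) (x y : ℝ → V) (x' y' : ℝ → V) (h0 : y 0 = x 0)
    (hx : ∀ t ∈ Set.Icc (0 : ℝ) T, HasDerivAt x (x' t) t)
    (hy : ∀ t ∈ Set.Icc (0 : ℝ) T, HasDerivAt y (y' t) t)
    (hb : ∀ t ∈ Set.Icc (0 : ℝ) T, ‖y t - x t‖ ≤ η → ‖y' t - x' t‖ < L * ‖y t - x t‖ + δ) :
    ∀ t ∈ Set.Icc (0 : ℝ) T, ‖y t - x t‖ ≤ η := by
  have hexp : ∀ c t : ℝ, HasDerivAt (fun t => Real.exp (c * t)) (Real.exp (c * t) * c) t := by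
    intro c t
    simpa using ((hasDerivAt_id t).const_mul c).exp
  have hB : ∀ t ∈ Set.Icc (0 : ℝ) T, Real.exp ((L + 1) * t) * δ ≤ η := by
    intro t ht
    refine le_trans ?_ hδη
    rw [mul_comm]
    gcongr
    exact ht.2
  have hd : ∀ t ∈ Set.Icc (0 : ℝ) T, HasDerivAt (fun t => y t - x t) (y' t - x' t) t :=
    fun t ht => (hy t ht).sub (hx t ht)
  have key := image_norm_le_of_norm_deriv_right_lt_deriv_boundary (a := 0) (b := T)
    (B := fun t => Real.exp ((L + 1) * t) * δ)
    (fun t ht => (hd t ht).continuousAt.continuousWithinAt)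
    (fun t ht => (hd t ⟨ht.1, ht.2.le⟩).hasDerivWithinAt)
    (by simp [h0, hδ.le]) (fun t => (hexp (L + 1) t).mul_const δ) (by
      intro t ht heq
      have ht' : t ∈ Set.Icc (0 : ℝ) T := ⟨ht.1, ht.2.le⟩
      have h1 := hb t ht' (heq.le.trans (hB t ht'))
      rw [heq] at h1
      have h2 : 1 ≤ Real.exp ((L + 1) * t) :=
        Real.one_le_exp (mul_nonneg (by linarith) ht.1)
      nlinarith)
  exact fun t ht => (key ht).trans (hB t ht)

theorem lipschitz_near {V : Type*} [NormedAddCommGroup V] [NormedSpace ℝ V]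
    (D N K : Set V) (hD : IsOpen D) (hN : IsCompact N) (hND : N ⊆ D) (R : V → V)
    (hR : ContDiffOn ℝ 1 R D) (η : ℝ) (hKN : ∀ x ∈ K, Metric.closedBall x η ⊆ N) :
    ∃ L : ℝ, 0 ≤ L ∧ ∀ x ∈ K, ∀ y, ‖y - x‖ ≤ η → ‖R y - R x‖ ≤ L * ‖y - x‖ := by
  have hc : ContinuousOn (fderiv ℝ R) N :=
    (hR.continuousOn_fderiv_of_isOpen hD le_rfl).mono hND
  obtain ⟨C, hC⟩ := hN.exists_bound_of_continuousOn hc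
  refine ⟨max C 0, le_max_right _ _, fun x hx y hy => ?_⟩
  have hη : 0 ≤ η := (norm_nonneg _).trans hy
  refine (convex_closedBall x η).norm_image_sub_le_of_norm_fderiv_le (𝕜 := ℝ) (fun z hz => ?_)
    (fun z hz => (hC z (hKN x hx hz)).trans (le_max_left _ _))
    (Metric.mem_closedBall_self hη) (by simpa [dist_eq_norm] using hy)
  exact ((hR.differentiableOn one_ne_zero) z (hND (hKN x hx hz))).differentiableAt
    (hD.mem_nhds (hND (hKN x hx hz)))

theorem hasDerivAt_euclid {ι : Type*} [Fintype ι] {f : ℝ → EuclideanSpace ℝ ι}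
    {f' : EuclideanSpace ℝ ι} {t : ℝ} :
    HasDerivAt f f' t ↔ ∀ i, HasDerivAt (fun s => f s i) (f' i) t := by
  rw [← hasDerivAt_pi (φ := fun s i => f s i) (φ' := fun i => f' i)]
  constructor
  · intro h
    exact (EuclideanSpace.equiv ι ℝ).toContinuousLinearMap.hasFDerivAt.comp_hasDerivAt t h
  · intro h
    exact (EuclideanSpace.equiv ι ℝ).symm.toContinuousLinearMap.hasFDerivAt.comp_hasDerivAt t h

/-- **Theorem 3 of the paper**: the augmented driven system `ẋ = R(x) + E x` on
`ℝ^{n+p}`, whose solutions starting in `K` stay in the compact set `K̃ ⊆ D` on `[0,T]`,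
can be approximated to arbitrary accuracy `ε` by a forced recurrent neural network
`ż = -(1/τ)z + W σ(z) + H z` with `W = [[0, A], [0, BA]]`, `H = [[E, 0], [0, 0]]`, and
initial state `z(0) = (x(0), B x(0) + θ)`; the output units `ϖ` (first `n+p` components
of `z`) track `x(t)` to within `ε` on `[0,T]`, and in particular the first `n`
components of `x` and `ϖ` stay within `ε` of each other. -/
theorem frnn_approximates_driven_system
    (n p : ℕ) (D : Set (EuclideanSpace ℝ (Fin n ⊕ Fin p))) (hD : IsOpen D)
    (R : EuclideanSpace ℝ (Fin n ⊕ Fin p) → EuclideanSpace ℝ (Fin n ⊕ Fin p))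
    (hR : ContDiffOn ℝ 1 R D)
    (E : Matrix (Fin n ⊕ Fin p) (Fin n ⊕ Fin p) ℝ)
    (Ktilde : Set (EuclideanSpace ℝ (Fin n ⊕ Fin p))) (hKt : IsCompact Ktilde)
    (hKtD : Ktilde ⊆ D)
    (K : Set (EuclideanSpace ℝ (Fin n ⊕ Fin p))) (hK : K ⊆ Ktilde)
    (T : ℝ) (hT : 0 < T)
    (hsol : ∀ x : ℝ → EuclideanSpace ℝ (Fin n ⊕ Fin p),
      (∀ t ∈ Set.Icc (0 : ℝ) T,
        HasDerivAt x (R (x t) +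
          (EuclideanSpace.equiv (Fin n ⊕ Fin p) ℝ).symm (E.mulVec (x t))) t) →
      x 0 ∈ K → ∀ t ∈ Set.Icc (0 : ℝ) T, x t ∈ Ktilde)
    (ε : ℝ) (hε : 0 < ε) :
    ∃ (m : ℕ) (τ : ℝ) (A : Matrix (Fin n ⊕ Fin p) (Fin m) ℝ)
      (B : Matrix (Fin m) (Fin n ⊕ Fin p) ℝ) (θ : EuclideanSpace ℝ (Fin m)),
      1 ≤ m ∧ 0 < τ ∧
      ∀ x : ℝ → EuclideanSpace ℝ (Fin n ⊕ Fin p),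
        (∀ t ∈ Set.Icc (0 : ℝ) T,
          HasDerivAt x (R (x t) +
            (EuclideanSpace.equiv (Fin n ⊕ Fin p) ℝ).symm (E.mulVec (x t))) t) →
        x 0 ∈ K →
        ∀ z : ℝ → EuclideanSpace ℝ ((Fin n ⊕ Fin p) ⊕ Fin m),
          (∀ t ∈ Set.Icc (0 : ℝ) T, HasDerivAt z
            ((-(1 / τ)) • z t
              + (EuclideanSpace.equiv ((Fin n ⊕ Fin p) ⊕ Fin m) ℝ).symm
                  ((Matrix.fromBlocks 0 A 0 (B * A)).mulVec (fun j => sigmoid (z t j)))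
              + (EuclideanSpace.equiv ((Fin n ⊕ Fin p) ⊕ Fin m) ℝ).symm
                  ((Matrix.fromBlocks E 0 0 0).mulVec (z t))) t) →
          z 0 = (EuclideanSpace.equiv ((Fin n ⊕ Fin p) ⊕ Fin m) ℝ).symm
            (Sum.elim (x 0) (fun i => B.mulVec (x 0) i + θ i)) →
          ∀ t ∈ Set.Icc (0 : ℝ) T,
            ‖x t - (EuclideanSpace.equiv (Fin n ⊕ Fin p) ℝ).symm
                (fun i => z t (Sum.inl i))‖ < ε ∧
            ‖(EuclideanSpace.equiv (Fin n) ℝ).symm (fun i : Fin n => x t (Sum.inl i))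
              - (EuclideanSpace.equiv (Fin n) ℝ).symm
                  (fun i : Fin n => z t (Sum.inl (Sum.inl i)))‖ ≤ ε := by
  classical
  let Em : EuclideanSpace ℝ (Fin n ⊕ Fin p) →L[ℝ] EuclideanSpace ℝ (Fin n ⊕ Fin p) :=
    Matrix.toEuclideanCLM (𝕜 := ℝ) E
  have hEm : ∀ x : EuclideanSpace ℝ (Fin n ⊕ Fin p),
      (EuclideanSpace.equiv (Fin n ⊕ Fin p) ℝ).symm (E.mulVec x) = Em x := fun _ => rfl
  simp only [hEm] at hsol ⊢
  obtain ⟨η₀, hη₀, hη₀D⟩ := hKt.exists_cthickening_subset_open hD hKtD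
  set η := min η₀ (ε / 4) with hη
  have hη0 : 0 < η := lt_min hη₀ (by linarith)
  have hηε : η ≤ ε / 4 := min_le_right _ _
  set N := Metric.cthickening η Ktilde with hN
  have hNc : IsCompact N := hKt.cthickening
  have hND : N ⊆ D := (Metric.cthickening_mono (min_le_left _ _) _).trans hη₀D
  have hball : ∀ x ∈ Ktilde, Metric.closedBall x η ⊆ N := fun x hx =>
    Metric.closedBall_subset_cthickening hx η
  obtain ⟨L₀, hL₀, hLip⟩ := lipschitz_near D N Ktilde hD hNc hND R hR η hball
  obtain ⟨M₀, hM₀⟩ := hNc.isBounded.exists_norm_le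
  set M := max M₀ 0 with hMdef
  have hM0 : 0 ≤ M := le_max_right _ _
  set L := L₀ + ‖Em‖ with hLdef
  have hL : 0 ≤ L := by positivity
  set r := ε / 2 with hr
  have hr0 : 0 < r := by positivity
  set τ := r / (‖Em‖ * (r + M) + 1) with hτdef
  have hden : 0 < ‖Em‖ * (r + M) + 1 := by positivity
  have hτ : 0 < τ := by positivity
  have hrτ : ‖Em‖ * (r + M) < r / τ := by
    rw [hτdef, div_div_cancel₀ hr0.ne']
    linarith
  set δ := η * Real.exp (-((L + 1) * T)) with hδdef
  have hδ : 0 < δ := by positivity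
  have hδη : δ * Real.exp ((L + 1) * T) ≤ η := by
    rw [hδdef, mul_assoc, ← Real.exp_add]; simp
  have hFc : ContinuousOn (fun y => R y + Em y + (1 / τ) • y) N :=
    ((hR.continuousOn.mono hND).add Em.continuous.continuousOn).add
      (continuous_const_smul (1 / τ)).continuousOn
  obtain ⟨m, A, B, θ, hm, happ⟩ := network_approx N hNc _ hFc
    (Real.exp (-(1 / τ) * T)) (Real.exp_pos _) δ hδ
  refine ⟨m, τ, A, B, θ, hm, hτ, ?_⟩
  intro x hx hx0 z hz hz0
  have hxK := hsol x hx hx0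
  let Bl : EuclideanSpace ℝ (Fin n ⊕ Fin p) →L[ℝ] EuclideanSpace ℝ (Fin m) :=
    LinearMap.toContinuousLinearMap (Matrix.toEuclideanLin B)
  have hBl : ∀ v i, Bl v i = B.mulVec v i := fun _ _ => rfl
  let q : EuclideanSpace ℝ (Fin m) → EuclideanSpace ℝ (Fin n ⊕ Fin p) := fun h =>
    WithLp.toLp 2 (A.mulVec fun j => sigmoid (h j))
  let ω : ℝ → EuclideanSpace ℝ (Fin n ⊕ Fin p) := fun t =>
    WithLp.toLp 2 fun i => z t (Sum.inl i)
  let h : ℝ → EuclideanSpace ℝ (Fin m) := fun t => WithLp.toLp 2 fun i => z t (Sum.inr i)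
  have hω : ∀ t ∈ Set.Icc (0 : ℝ) T,
      HasDerivAt ω ((-(1 / τ)) • ω t + q (h t) + Em (ω t)) t := by
    intro t ht
    rw [hasDerivAt_euclid]
    intro i
    have h1 := hasDerivAt_euclid.mp (hz t ht) (Sum.inl i)
    refine HasDerivAt.congr_deriv h1 ?_
    simp [Matrix.mulVec, dotProduct, Matrix.fromBlocks, Em, q, ω, h, Fintype.sum_sum_type]
  have hh : ∀ t ∈ Set.Icc (0 : ℝ) T,
      HasDerivAt h ((-(1 / τ)) • h t + Bl (q (h t))) t := by
    intro t ht
    rw [hasDerivAt_euclid]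
    intro i
    have h1 := hasDerivAt_euclid.mp (hz t ht) (Sum.inr i)
    refine HasDerivAt.congr_deriv h1 ?_
    have h2 : Bl (q (h t)) i = (B * A).mulVec (fun j => sigmoid (h t j)) i := by
      rw [hBl, ← Matrix.mulVec_mulVec]
    change _ = (-(1 / τ) • h t) i + Bl (q (h t)) i
    rw [h2]
    simp [Matrix.mulVec, dotProduct, Matrix.fromBlocks, h, Fintype.sum_sum_type]
  have hω0 : ω 0 = x 0 := by
    ext i; simp [ω, hz0]
  have hh0 : h 0 = Bl (ω 0) + θ := by
    rw [hω0]; ext i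
    rw [PiLp.add_apply, hBl]
    simp [h, hz0]
  obtain ⟨w, hw0, hw, hhw⟩ := exists_lag T τ hT Em Bl q θ ω h hω hh hh0
  let y : ℝ → EuclideanSpace ℝ (Fin n ⊕ Fin p) := fun t => ω t - w t
  have hy : ∀ t ∈ Set.Icc (0 : ℝ) T,
      HasDerivAt y ((-(1 / τ)) • y t + q (h t)) t := by
    intro t ht
    refine HasDerivAt.congr_deriv ((hω t ht).sub (hw t ht)) ?_
    simp only [y]
    module
  have hyN : ∀ t ∈ Set.Icc (0 : ℝ) T, ‖y t - x t‖ ≤ η → y t ∈ N := fun t ht hle =>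
    hball _ (hxK t ht) (by simpa [dist_eq_norm] using hle)
  have htrack := tracking T L η δ hL hδ hδη x y _ _ (by simp [y, hw0, hω0]) hx hy (by
    intro t ht hle
    have hyt := hyN t ht hle
    have h1 := happ (y t) hyt (Real.exp (-(1 / τ) * t)) ⟨by
        apply Real.exp_le_exp.mpr
        have : 0 ≤ 1 / τ := by positivity
        nlinarith [ht.2], by
        rw [Real.exp_le_one_iff]
        have : 0 ≤ 1 / τ := by positivity
        nlinarith [ht.1]⟩
    have h2 : q (h t) = WithLp.toLp 2 (A.mulVec (fun j => sigmoid (B.mulVec (y t) j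
        + Real.exp (-(1 / τ) * t) * θ j))) := by
      rw [hhw t ht]
      rfl
    rw [← h2] at h1
    have h3 := hLip (x t) (hxK t ht) (y t) hle
    have h4 := Em.le_opNorm (y t - x t)
    have h5 : (-(1 / τ)) • y t + q (h t) - (R (x t) + Em (x t))
        = (q (h t) - (R (y t) + Em (y t) + (1 / τ) • y t)) + (R (y t) - R (x t))
          + Em (y t - x t) := by
      rw [map_sub Em (y t) (x t)]; module
    rw [h5]
    have h6 := norm_add₃_le (a := q (h t) - (R (y t) + Em (y t) + (1 / τ) • y t))
      (b := R (y t) - R (x t)) (c := Em (y t - x t))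
    have h7 : L * ‖y t - x t‖ = L₀ * ‖y t - x t‖ + ‖Em‖ * ‖y t - x t‖ := by
      rw [hLdef]; ring
    linarith)
  have hwr := lag_small T τ M r Em ω w hw0 hr0 hw
    (fun t ht => (hM₀ _ (hyN t ht (htrack t ht))).trans (le_max_left _ _)) hrτ
  intro t ht
  have hfin : ‖x t - ω t‖ < ε := by
    have e : x t - ω t = -(y t - x t) - w t := by simp only [y]; abel
    rw [e]
    have := norm_sub_le (-(y t - x t)) (w t)
    rw [norm_neg] at this
    linarith [htrack t ht, hwr t ht]
  refine ⟨hfin, le_trans ?_ hfin.le⟩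
  rw [EuclideanSpace.norm_eq, EuclideanSpace.norm_eq]
  apply Real.sqrt_le_sqrt
  rw [Fintype.sum_sum_type]
  refine le_add_of_le_of_nonneg (le_of_eq ?_) (Finset.sum_nonneg fun i _ => by positivity)
  rfl
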